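/- Let u : ℝ³ → ℝ be a smooth solution of the modified Veronese web equation u_ty = u_t u_xy − u_y u_tx with u_y nowhere vanishing, and let v : ℝ³ → ℝ be a smooth function satisfying v_t = u_t / u_y and v_x = 1 / u_y at every point. Then v satisfies v_tx = v_t v_xy − v_x v_ty at every point; equivalently, the function w(x, y, t) := v(y, x, t) obtained from v by interchanging x and y satisfies the modified Veronese web equation w_ty = w_t w_xy − w_y w_tx. (The superposition of the system v_t = u_t/u_y, v_x = 1/u_y with the swap x ↔ y is a Bäcklund auto-transformation of the modified Veronese web equation.) -/

import Mathlib

noncomputable section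

/-- Partial derivative with respect to the first variable (`x`). -/
def Dx (f : ℝ → ℝ → ℝ → ℝ) (x y t : ℝ) : ℝ := deriv (fun x' => f x' y t) x

/-- Partial derivative with respect to the second variable (`y`). -/
def Dy (f : ℝ → ℝ → ℝ → ℝ) (x y t : ℝ) : ℝ := deriv (fun y' => f x y' t) y

/-- Partial derivative with respect to the third variable (`t`). -/
def Dt (f : ℝ → ℝ → ℝ → ℝ) (x y t : ℝ) : ℝ := deriv (fun t' => f x y t') t

/-- Smoothness of a function of three real variables `(x, y, t)`. -/
def Smooth3 (f : ℝ → ℝ → ℝ → ℝ) : Prop :=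
  ContDiff ℝ (⊤ : ℕ∞) (fun p : ℝ × ℝ × ℝ => f p.1 p.2.1 p.2.2)

/-- The function of `p : ℝ × ℝ × ℝ` obtained by uncurrying. -/
abbrev uncurry3 (f : ℝ → ℝ → ℝ → ℝ) : ℝ × ℝ × ℝ → ℝ := fun p => f p.1 p.2.1 p.2.2

theorem Smooth3.hasFDerivAt {f : ℝ → ℝ → ℝ → ℝ} (hf : Smooth3 f) (p : ℝ × ℝ × ℝ) :
    HasFDerivAt (uncurry3 f) (fderiv ℝ (uncurry3 f) p) p :=
  (hf.differentiable (by simp) p).hasFDerivAt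

theorem Smooth3.hasDerivAt_x {f : ℝ → ℝ → ℝ → ℝ} (hf : Smooth3 f) (x y t : ℝ) :
    HasDerivAt (fun x' => f x' y t) (fderiv ℝ (uncurry3 f) (x, y, t) (1, 0, 0)) x :=
  HasFDerivAt.comp_hasDerivAt (l := uncurry3 f) x (hf.hasFDerivAt (x, y, t))
    ((hasDerivAt_id x).prodMk ((hasDerivAt_const x y).prodMk (hasDerivAt_const x t)))

theorem Smooth3.hasDerivAt_y {f : ℝ → ℝ → ℝ → ℝ} (hf : Smooth3 f) (x y t : ℝ) :
    HasDerivAt (fun y' => f x y' t) (fderiv ℝ (uncurry3 f) (x, y, t) (0, 1, 0)) y :=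
  HasFDerivAt.comp_hasDerivAt (l := uncurry3 f) y (hf.hasFDerivAt (x, y, t))
    ((hasDerivAt_const y x).prodMk ((hasDerivAt_id y).prodMk (hasDerivAt_const y t)))

theorem Smooth3.hasDerivAt_t {f : ℝ → ℝ → ℝ → ℝ} (hf : Smooth3 f) (x y t : ℝ) :
    HasDerivAt (fun t' => f x y t') (fderiv ℝ (uncurry3 f) (x, y, t) (0, 0, 1)) t :=
  HasFDerivAt.comp_hasDerivAt (l := uncurry3 f) t (hf.hasFDerivAt (x, y, t))
    ((hasDerivAt_const t x).prodMk ((hasDerivAt_const t y).prodMk (hasDerivAt_id t)))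

theorem Smooth3.uncurry3_Dx {f : ℝ → ℝ → ℝ → ℝ} (hf : Smooth3 f) :
    uncurry3 (Dx f) = fun p => fderiv ℝ (uncurry3 f) p (1, 0, 0) :=
  funext fun p => (hf.hasDerivAt_x p.1 p.2.1 p.2.2).deriv

theorem Smooth3.uncurry3_Dy {f : ℝ → ℝ → ℝ → ℝ} (hf : Smooth3 f) :
    uncurry3 (Dy f) = fun p => fderiv ℝ (uncurry3 f) p (0, 1, 0) :=
  funext fun p => (hf.hasDerivAt_y p.1 p.2.1 p.2.2).deriv

theorem Smooth3.uncurry3_Dt {f : ℝ → ℝ → ℝ → ℝ} (hf : Smooth3 f) :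
    uncurry3 (Dt f) = fun p => fderiv ℝ (uncurry3 f) p (0, 0, 1) :=
  funext fun p => (hf.hasDerivAt_t p.1 p.2.1 p.2.2).deriv

theorem Smooth3.contDiff_fderiv {f : ℝ → ℝ → ℝ → ℝ} (hf : Smooth3 f) :
    ContDiff ℝ (⊤ : ℕ∞) (fderiv ℝ (uncurry3 f)) :=
  ContDiff.fderiv_right (n := (⊤ : ℕ∞)) hf (by simp)

theorem Smooth3.smooth3_Dx {f : ℝ → ℝ → ℝ → ℝ} (hf : Smooth3 f) : Smooth3 (Dx f) := by
  change ContDiff ℝ _ (uncurry3 (Dx f))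
  rw [hf.uncurry3_Dx]
  exact hf.contDiff_fderiv.clm_apply contDiff_const

theorem Smooth3.smooth3_Dy {f : ℝ → ℝ → ℝ → ℝ} (hf : Smooth3 f) : Smooth3 (Dy f) := by
  change ContDiff ℝ _ (uncurry3 (Dy f))
  rw [hf.uncurry3_Dy]
  exact hf.contDiff_fderiv.clm_apply contDiff_const

theorem Smooth3.smooth3_Dt {f : ℝ → ℝ → ℝ → ℝ} (hf : Smooth3 f) : Smooth3 (Dt f) := by
  change ContDiff ℝ _ (uncurry3 (Dt f))
  rw [hf.uncurry3_Dt]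
  exact hf.contDiff_fderiv.clm_apply contDiff_const

/-- Symmetry of second directional derivatives of a smooth function. -/
theorem Smooth3.fderiv_fderiv_apply_comm {f : ℝ → ℝ → ℝ → ℝ} (hf : Smooth3 f)
    (p a b : ℝ × ℝ × ℝ) :
    fderiv ℝ (fun q => fderiv ℝ (uncurry3 f) q a) p b =
      fderiv ℝ (fun q => fderiv ℝ (uncurry3 f) q b) p a := by
  have hd : DifferentiableAt ℝ (fderiv ℝ (uncurry3 f)) p :=
    hf.contDiff_fderiv.differentiable (by simp) p
  have happ (c d : ℝ × ℝ × ℝ) : fderiv ℝ (fun q => fderiv ℝ (uncurry3 f) q c) p d =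
      fderiv ℝ (fderiv ℝ (uncurry3 f)) p d c := by
    rw [fderiv_clm_apply hd (differentiableAt_const c)]
    simp
  rw [happ, happ]
  exact second_derivative_symmetric (fun q => hf.hasFDerivAt q) hd.hasFDerivAt b a

theorem Smooth3.Dx_Dy_comm {f : ℝ → ℝ → ℝ → ℝ} (hf : Smooth3 f) (x y t : ℝ) :
    Dx (Dy f) x y t = Dy (Dx f) x y t := by
  have h₁ := (hf.smooth3_Dy.hasDerivAt_x x y t).deriv
  have h₂ := (hf.smooth3_Dx.hasDerivAt_y x y t).deriv
  rw [hf.uncurry3_Dy, hf.fderiv_fderiv_apply_comm, ← hf.uncurry3_Dx] at h₁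
  exact h₁.trans h₂.symm

theorem Smooth3.Dt_Dy_comm {f : ℝ → ℝ → ℝ → ℝ} (hf : Smooth3 f) (x y t : ℝ) :
    Dt (Dy f) x y t = Dy (Dt f) x y t := by
  have h₁ := (hf.smooth3_Dy.hasDerivAt_t x y t).deriv
  have h₂ := (hf.smooth3_Dt.hasDerivAt_y x y t).deriv
  rw [hf.uncurry3_Dy, hf.fderiv_fderiv_apply_comm, ← hf.uncurry3_Dt] at h₁
  exact h₁.trans h₂.symm

/-- Bäcklund auto-transformation of the modified Veronese web equation: if `v_t = u_t/u_y`
and `v_x = 1/u_y` for a solution `u` of the mVWE, then `v_tx = v_t v_xy - v_x v_ty`, i.e.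
the function `w (x, y, t) = v (y, x, t)` again solves the mVWE. -/
theorem mvwe_backlund_auto_transformation
    (u : ℝ → ℝ → ℝ → ℝ) (hu : Smooth3 u)
    (husol : ∀ x y t : ℝ, Dt (Dy u) x y t = Dt u x y t * Dx (Dy u) x y t - Dy u x y t * Dt (Dx u) x y t)
    (huy : ∀ x y t : ℝ, Dy u x y t ≠ 0)
    (v : ℝ → ℝ → ℝ → ℝ) (hv : Smooth3 v)
    (hvt : ∀ x y t : ℝ, Dt v x y t = Dt u x y t / Dy u x y t)
    (hvx : ∀ x y t : ℝ, Dx v x y t = 1 / Dy u x y t) :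
    (∀ x y t : ℝ,
      Dt (Dx v) x y t = Dt v x y t * Dx (Dy v) x y t - Dx v x y t * Dt (Dy v) x y t) ∧
    (∀ x y t : ℝ,
      Dt (Dy (fun a b c => v b a c)) x y t =
        Dt (fun a b c => v b a c) x y t * Dx (Dy (fun a b c => v b a c)) x y t
          - Dy (fun a b c => v b a c) x y t * Dt (Dx (fun a b c => v b a c)) x y t) := by
  have key (x y t : ℝ) :
      Dt (Dx v) x y t = Dt v x y t * Dx (Dy v) x y t - Dx v x y t * Dt (Dy v) x y t := by
    have hne := huy x y t
    have hpt : HasDerivAt (fun s => Dy u x y s) (Dt (Dy u) x y t) t :=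
      (hu.smooth3_Dy.hasDerivAt_t x y t).differentiableAt.hasDerivAt
    have hpy : HasDerivAt (fun s => Dy u x s t) (Dy (Dy u) x y t) y :=
      (hu.smooth3_Dy.hasDerivAt_y x y t).differentiableAt.hasDerivAt
    have hqy : HasDerivAt (fun s => Dt u x s t) (Dt (Dy u) x y t) y := by
      rw [hu.Dt_Dy_comm]
      exact (hu.smooth3_Dt.hasDerivAt_y x y t).differentiableAt.hasDerivAt
    have htx : Dt (Dx v) x y t = -Dt (Dy u) x y t / Dy u x y t ^ 2 := by
      simp only [Dt, hvx, one_div]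
      exact (hpt.fun_inv hne).deriv
    have hxy : Dx (Dy v) x y t = -Dy (Dy u) x y t / Dy u x y t ^ 2 := by
      rw [hv.Dx_Dy_comm, Dy]
      simp only [hvx, one_div]
      exact (hpy.fun_inv hne).deriv
    have hty : Dt (Dy v) x y t =
        (Dt (Dy u) x y t * Dy u x y t - Dt u x y t * Dy (Dy u) x y t) / Dy u x y t ^ 2 := by
      rw [hv.Dt_Dy_comm, Dy]
      simp only [hvt]
      exact (hqy.fun_div hpy hne).deriv
    rw [htx, hxy, hty, hvt, hvx]
    field_simp
    ring
  refine ⟨key, fun x y t => ?_⟩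
  have h := key y x t
  rw [hv.Dx_Dy_comm] at h
  exact h
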